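/- Theorem 3.3 (implication 1 ⇒ 4): Let F be a symmetric third-order multilinear form on ℝⁿ with score function S(x) = F(x,x,x), and let D ⊆ ℝⁿ be a nonempty compact set. If for every x ∈ D the Hessian of S at x is positive semidefinite — equivalently, F(x,t,t) ≥ 0 for all x ∈ D and all t ∈ ℝⁿ — then max_{x,y,z ∈ D} F(x,y,z) = max_{x,y ∈ D} F(x,x,y) = max_{x ∈ D} F(x,x,x). -/

import Mathlib

open Finset

/-- The trilinear form associated to a third-order tensor `𝓕` on `ℝⁿ`. -/
def triForm {n : ℕ} (𝓕 : Fin n → Fin n → Fin n → ℝ) (x y z : Fin n → ℝ) : ℝ :=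
  ∑ i, ∑ j, ∑ k, 𝓕 i j k * x i * y j * z k

theorem triForm_swap12 {n : ℕ} (𝓕 : Fin n → Fin n → Fin n → ℝ)
    (hs : ∀ i j k, 𝓕 i j k = 𝓕 j i k) (x y z : Fin n → ℝ) :
    triForm 𝓕 x y z = triForm 𝓕 y x z := by
  unfold triForm
  rw [Finset.sum_comm]
  refine Finset.sum_congr rfl fun i _ => Finset.sum_congr rfl fun j _ =>
    Finset.sum_congr rfl fun k _ => ?_
  rw [hs j i k]; ring

theorem triForm_swap23 {n : ℕ} (𝓕 : Fin n → Fin n → Fin n → ℝ)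
    (hs : ∀ i j k, 𝓕 i j k = 𝓕 i k j) (x y z : Fin n → ℝ) :
    triForm 𝓕 x y z = triForm 𝓕 x z y := by
  unfold triForm
  refine Finset.sum_congr rfl fun i _ => ?_
  rw [Finset.sum_comm]
  refine Finset.sum_congr rfl fun j _ => Finset.sum_congr rfl fun k _ => ?_
  rw [hs i k j]; ring

theorem triForm_expand {n : ℕ} (𝓕 : Fin n → Fin n → Fin n → ℝ) (z x y : Fin n → ℝ) :
    triForm 𝓕 z (x - y) (x - y) =
      triForm 𝓕 z x x - triForm 𝓕 z x y - triForm 𝓕 z y x + triForm 𝓕 z y y := by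
  unfold triForm
  simp only [← Finset.sum_sub_distrib, ← Finset.sum_add_distrib, Pi.sub_apply]
  refine Finset.sum_congr rfl fun i _ => Finset.sum_congr rfl fun j _ =>
    Finset.sum_congr rfl fun k _ => ?_
  ring

/-- Theorem 3.3, implication 1 ⇒ 4: if the Hessian of the score function `S(x) = F(x,x,x)`
is positive semidefinite at every `x ∈ D` — equivalently `F(x,t,t) ≥ 0` for all `x ∈ D`
and all `t ∈ ℝⁿ` — then, for `D` nonempty and compact,
`max_{x,y,z ∈ D} F(x,y,z) = max_{x,y ∈ D} F(x,x,y) = max_{x ∈ D} F(x,x,x)`. -/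
theorem thm33_one_implies_four {n : ℕ} (hn : 1 ≤ n)
    (𝓕 : Fin n → Fin n → Fin n → ℝ)
    (hsym₁ : ∀ i j k, 𝓕 i j k = 𝓕 j i k)
    (hsym₂ : ∀ i j k, 𝓕 i j k = 𝓕 i k j)
    (D : Set (Fin n → ℝ)) (hD : IsCompact D) (hDne : D.Nonempty)
    (h : ∀ x ∈ D, ∀ t : Fin n → ℝ, 0 ≤ triForm 𝓕 x t t) :
    sSup {r : ℝ | ∃ x ∈ D, ∃ y ∈ D, ∃ z ∈ D, triForm 𝓕 x y z = r}
        = sSup {r : ℝ | ∃ x ∈ D, ∃ y ∈ D, triForm 𝓕 x x y = r}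
      ∧ sSup {r : ℝ | ∃ x ∈ D, ∃ y ∈ D, triForm 𝓕 x x y = r}
        = sSup {r : ℝ | ∃ x ∈ D, triForm 𝓕 x x x = r} := by
  have key : ∀ z ∈ D, ∀ x y, 2 * triForm 𝓕 z x y ≤ triForm 𝓕 z x x + triForm 𝓕 z y y := by
    intro z hz x y
    have h1 := h z hz (x - y)
    rw [triForm_expand, triForm_swap23 𝓕 hsym₂ z y x] at h1
    linarith
  have cyc : ∀ x y, triForm 𝓕 x y y = triForm 𝓕 y y x := fun x y => by
    rw [triForm_swap12 𝓕 hsym₁, triForm_swap23 𝓕 hsym₂]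
  have bdd3 : BddAbove {r : ℝ | ∃ x ∈ D, ∃ y ∈ D, ∃ z ∈ D, triForm 𝓕 x y z = r} := by
    have hc : Continuous fun p : (Fin n → ℝ) × (Fin n → ℝ) × (Fin n → ℝ) =>
        triForm 𝓕 p.1 p.2.1 p.2.2 := by
      unfold triForm
      fun_prop
    refine ((hD.prod (hD.prod hD)).image hc).bddAbove.mono ?_
    rintro r ⟨x, hx, y, hy, z, hz, rfl⟩
    exact ⟨(x, y, z), ⟨hx, hy, hz⟩, rfl⟩
  have bdd2 : BddAbove {r : ℝ | ∃ x ∈ D, ∃ y ∈ D, triForm 𝓕 x x y = r} := by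
    refine bdd3.mono ?_
    rintro r ⟨x, hx, y, hy, rfl⟩
    exact ⟨x, hx, x, hx, y, hy, rfl⟩
  have bdd1 : BddAbove {r : ℝ | ∃ x ∈ D, triForm 𝓕 x x x = r} := by
    refine bdd3.mono ?_
    rintro r ⟨x, hx, rfl⟩
    exact ⟨x, hx, x, hx, x, hx, rfl⟩
  obtain ⟨d, hd⟩ := hDne
  have le2 : ∀ x ∈ D, ∀ y ∈ D, triForm 𝓕 x x y ≤
      sSup {r : ℝ | ∃ x ∈ D, ∃ y ∈ D, triForm 𝓕 x x y = r} :=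
    fun x hx y hy => le_csSup bdd2 ⟨x, hx, y, hy, rfl⟩
  have le1 : ∀ x ∈ D, triForm 𝓕 x x x ≤ sSup {r : ℝ | ∃ x ∈ D, triForm 𝓕 x x x = r} :=
    fun x hx => le_csSup bdd1 ⟨x, hx, rfl⟩
  constructor
  · apply le_antisymm
    · refine csSup_le ⟨_, d, hd, d, hd, d, hd, rfl⟩ ?_
      rintro r ⟨x, hx, y, hy, z, hz, rfl⟩
      have h1 := key x hx y z
      rw [cyc x y, cyc x z] at h1
      linarith [le2 y hy x hx, le2 z hz x hx]
    · refine csSup_le ⟨_, d, hd, d, hd, rfl⟩ ?_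
      rintro r ⟨x, hx, y, hy, rfl⟩
      exact le_csSup bdd3 ⟨x, hx, x, hx, y, hy, rfl⟩
  · apply le_antisymm
    · have h2 : sSup {r : ℝ | ∃ x ∈ D, ∃ y ∈ D, triForm 𝓕 x x y = r} ≤
          (sSup {r : ℝ | ∃ x ∈ D, triForm 𝓕 x x x = r} +
            sSup {r : ℝ | ∃ x ∈ D, ∃ y ∈ D, triForm 𝓕 x x y = r}) / 2 := by
        refine csSup_le ⟨_, d, hd, d, hd, rfl⟩ ?_
        rintro r ⟨x, hx, y, hy, rfl⟩
        have h1 := key x hx x y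
        rw [cyc x y] at h1
        linarith [le2 y hy x hx, le1 x hx]
      linarith
    · refine csSup_le ⟨_, d, hd, rfl⟩ ?_
      rintro r ⟨x, hx, rfl⟩
      exact le_csSup bdd2 ⟨x, hx, x, hx, rfl⟩
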